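/- Let p be a prime and r any positive integer. If dim_{F_p} X_{r−1} = 2p + 2, then dim_{F_p} X_r = p + 1. -/

import Mathlib

open MvPolynomial

/-- The action of a 2×2 matrix `g` over `F_p` on polynomials in two variables:
`((a b; c d) · F)(X, Y) = F (aX + cY, bX + dY)`. -/
noncomputable def matAct (p : ℕ) (g : Matrix (Fin 2) (Fin 2) (ZMod p)) :
    MvPolynomial (Fin 2) (ZMod p) →ₐ[ZMod p] MvPolynomial (Fin 2) (ZMod p) :=
  aeval fun i => ∑ j, C (g j i) * X j

/-- The action of `g` twisted by the `n`-th power of the determinant character `D`. -/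
noncomputable def twAct (p n : ℕ) (g : Matrix (Fin 2) (Fin 2) (ZMod p))
    (F : MvPolynomial (Fin 2) (ZMod p)) : MvPolynomial (Fin 2) (ZMod p) :=
  g.det ^ n • matAct p g F

/-- `V_m`: homogeneous polynomials of degree `m` in two variables over `F_p`. -/
noncomputable def Vh (p m : ℕ) : Submodule (ZMod p) (MvPolynomial (Fin 2) (ZMod p)) :=
  homogeneousSubmodule (Fin 2) (ZMod p) m

/-- `X_r`: the `M`-submodule of `V_r` generated by `X^r`, realized as the span of the
orbit of `X^r` under the monoid `M = M_2(F_p)`. -/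
noncomputable def XrSub (p r : ℕ) : Submodule (ZMod p) (MvPolynomial (Fin 2) (ZMod p)) :=
  Submodule.span (ZMod p)
    (Set.range fun g : Matrix (Fin 2) (Fin 2) (ZMod p) => matAct p g (X 0 ^ r))

/-- `X_{r-1}`: the `M`-submodule of `V_r` generated by `X^{r-1} Y`. -/
noncomputable def Xr1Sub (p r : ℕ) : Submodule (ZMod p) (MvPolynomial (Fin 2) (ZMod p)) :=
  Submodule.span (ZMod p)
    (Set.range fun g : Matrix (Fin 2) (Fin 2) (ZMod p) => matAct p g (X 0 ^ (r - 1) * X 1))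

/-- The special polynomial `θ = X^p Y − X Y^p`. -/
noncomputable def theta (p : ℕ) : MvPolynomial (Fin 2) (ZMod p) :=
  X 0 ^ p * X 1 - X 0 * X 1 ^ p

/-- `V_r^* = {F ∈ V_r : θ ∣ F}`. -/
noncomputable def Vstar (p r : ℕ) : Submodule (ZMod p) (MvPolynomial (Fin 2) (ZMod p)) :=
  Vh p r ⊓ (Ideal.span {theta p}).restrictScalars (ZMod p)

/-- `V_r^{**} = {F ∈ V_r : θ² ∣ F}`. -/
noncomputable def Vdstar (p r : ℕ) : Submodule (ZMod p) (MvPolynomial (Fin 2) (ZMod p)) :=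
  Vh p r ⊓ (Ideal.span {theta p ^ 2}).restrictScalars (ZMod p)

/-- `M`-equivariance of a linear map between two submodules of the polynomial ring,
where the source carries the action twisted by `D^{nA}` and the target by `D^{nB}`. -/
def EquivMap (p nA nB : ℕ)
    {A B : Submodule (ZMod p) (MvPolynomial (Fin 2) (ZMod p))}
    (φ : A →ₗ[ZMod p] B) : Prop :=
  ∀ (g : Matrix (Fin 2) (Fin 2) (ZMod p)) (x y : A),
    (y : MvPolynomial (Fin 2) (ZMod p)) = twAct p nA g (x : MvPolynomial (Fin 2) (ZMod p)) →
    (φ y : MvPolynomial (Fin 2) (ZMod p)) = twAct p nB g (φ x : MvPolynomial (Fin 2) (ZMod p))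


/-- Representatives of the lines of linear forms: `Y` and `X + t Y` for `t ∈ F_p`. -/
noncomputable def lineForm (p : ℕ) : Option (ZMod p) → MvPolynomial (Fin 2) (ZMod p)
  | none => X 1
  | some t => X 0 + C t * X 1

/-- A linear form completing `lineForm p i` to a basis of the linear forms. -/
noncomputable def complForm (p : ℕ) : Option (ZMod p) → MvPolynomial (Fin 2) (ZMod p)
  | none => X 0
  | some _ => X 1

theorem matAct_X (p : ℕ) (g : Matrix (Fin 2) (Fin 2) (ZMod p)) (i : Fin 2) :
    matAct p g (X i) = C (g 0 i) * X 0 + C (g 1 i) * X 1 := by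
  simp [matAct, Fin.sum_univ_two]

theorem exists_eq_C_mul_lineForm (p : ℕ) [Fact p.Prime] (a c : ZMod p) :
    ∃ s i, C a * X 0 + C c * X 1 = C s * lineForm p i := by
  by_cases ha : a = 0
  · exact ⟨c, none, by simp [lineForm, ha]⟩
  · refine ⟨a, some (a⁻¹ * c), ?_⟩
    rw [lineForm, mul_add, ← mul_assoc, ← C_mul, mul_inv_cancel_left₀ ha]

theorem exists_eq_lineForm_add_complForm (p : ℕ) (b d : ZMod p) (i : Option (ZMod p)) :
    ∃ u v, C b * X 0 + C d * X 1 = C u * lineForm p i + C v * complForm p i := by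
  cases i with
  | none => exact ⟨d, b, add_comm _ _⟩
  | some t =>
    refine ⟨b, d - b * t, ?_⟩
    simp only [lineForm, complForm, C_sub, C_mul]
    ring

theorem exists_matAct_X_zero_eq_lineForm (p : ℕ) (i : Option (ZMod p)) :
    ∃ g, matAct p g (X 0) = lineForm p i := by
  cases i with
  | none => exact ⟨!![0, 0; 1, 0], by simp [matAct_X, lineForm]⟩
  | some t => exact ⟨!![1, 0; t, 0], by simp [matAct_X, lineForm]⟩

theorem XrSub_eq_span_lineForm (p r : ℕ) [Fact p.Prime] :
    XrSub p r = Submodule.span (ZMod p) (Set.range fun i => lineForm p i ^ r) := by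
  apply le_antisymm <;> rw [XrSub, Submodule.span_le]
  · rintro _ ⟨g, rfl⟩
    obtain ⟨s, i, hs⟩ := exists_eq_C_mul_lineForm p (g 0 0) (g 1 0)
    have key : matAct p g (X 0 ^ r) = s ^ r • lineForm p i ^ r := by
      rw [map_pow, matAct_X, hs, mul_pow, ← C_pow, smul_eq_C_mul]
    simp only [key]
    exact Submodule.smul_mem _ _ (Submodule.subset_span ⟨i, rfl⟩)
  · rintro _ ⟨i, rfl⟩
    obtain ⟨g, hg⟩ := exists_matAct_X_zero_eq_lineForm p i
    exact Submodule.subset_span ⟨g, by simp [hg]⟩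

theorem Xr1Sub_le_span_lineForm (p r : ℕ) [Fact p.Prime] (hr : 0 < r) :
    Xr1Sub p r ≤ Submodule.span (ZMod p) (Set.range
      (Sum.elim (fun i => lineForm p i ^ r)
        fun i => lineForm p i ^ (r - 1) * complForm p i)) := by
  rw [Xr1Sub, Submodule.span_le]
  rintro _ ⟨g, rfl⟩
  obtain ⟨s, i, hs⟩ := exists_eq_C_mul_lineForm p (g 0 0) (g 1 0)
  obtain ⟨u, v, huv⟩ := exists_eq_lineForm_add_complForm p (g 0 1) (g 1 1) i
  have key : matAct p g (X 0 ^ (r - 1) * X 1) =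
      (s ^ (r - 1) * u) • lineForm p i ^ r +
        (s ^ (r - 1) * v) • (lineForm p i ^ (r - 1) * complForm p i) := by
    obtain ⟨n, rfl⟩ : ∃ n, r = n + 1 := ⟨r - 1, by omega⟩
    simp only [map_mul, map_pow, matAct_X, hs, huv, smul_eq_C_mul, Nat.add_sub_cancel]
    ring
  simp only [key]
  exact add_mem (Submodule.smul_mem _ _ (Submodule.subset_span ⟨.inl i, rfl⟩))
    (Submodule.smul_mem _ _ (Submodule.subset_span ⟨.inr i, rfl⟩))

/-- For a prime `p` and any positive integer `r`, if
`dim X_{r−1} = 2p+2` then `dim X_r = p+1`. -/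
theorem dim_Xr_of_dim_Xr1 (p r : ℕ) (hp : p.Prime) (hr : 0 < r)
    (h : Module.finrank (ZMod p) ↥(Xr1Sub p r) = 2 * p + 2) :
    Module.finrank (ZMod p) ↥(XrSub p r) = p + 1 := by
  have : Fact p.Prime := ⟨hp⟩
  have hli : LinearIndependent (ZMod p) (Sum.elim (fun i => lineForm p i ^ r)
      fun i => lineForm p i ^ (r - 1) * complForm p i) := by
    rw [linearIndependent_iff_card_le_finrank_span, Set.finrank]
    have := Module.Finite.span_of_finite (ZMod p) (Set.finite_range (Sum.elim
      (fun i => lineForm p i ^ r) fun i => lineForm p i ^ (r - 1) * complForm p i))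
    have hle := Submodule.finrank_mono (Xr1Sub_le_span_lineForm p r hr)
    simp only [Fintype.card_sum, Fintype.card_option, ZMod.card]
    omega
  have hli' : LinearIndependent (ZMod p) fun i => lineForm p i ^ r :=
    hli.comp Sum.inl Sum.inl_injective
  rw [XrSub_eq_span_lineForm, finrank_span_eq_card hli']
  simp [ZMod.card]
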